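/- Let H(p) = −p·log p − (1−p)·log(1−p) be the binary entropy function (natural logarithm, 0·log 0 = 0). Fix δ with 0 < δ ≤ 1/2 and define J : [δ, 1−δ] → ℝ by J(c₀) = H(c₀) − (H(c₀−δ) + H(c₀+δ))/2. Then J attains its minimum over [δ, 1−δ] at c₀ = 1/2, i.e., J(c₀) ≥ J(1/2) for all c₀ ∈ [δ, 1−δ]; moreover J is monotone nondecreasing on [1/2, 1−δ] (and, by the symmetry J(1−c₀) = J(c₀), monotone nonincreasing on [δ, 1/2]). -/

import Mathlib

/-- The derivative `p ↦ log (1 - p) - log p` of the binary entropy is midpoint concave on the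
right half of the unit interval. -/
lemma binEntropy_slope_midpoint_concave {c δ : ℝ} (hδ : 0 ≤ δ) (hc : 1 / 2 ≤ c)
    (hcδ : δ < 1 - c) :
    ((Real.log (1 - (c - δ)) - Real.log (c - δ))
        + (Real.log (1 - (c + δ)) - Real.log (c + δ))) / 2
      ≤ Real.log (1 - c) - Real.log c := by
  have h₁ : 0 < 1 - (c - δ) := by linarith
  have h₂ : 0 < c - δ := by linarith
  have h₃ : 0 < 1 - (c + δ) := by linarith
  have h₄ : 0 < c + δ := by linarith
  have h₅ : 0 < 1 - c := by linarith
  have h₆ : 0 < c := by linarith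
  have key : ((1 - (c - δ)) * (1 - (c + δ))) * (c * c)
      ≤ ((1 - c) * (1 - c)) * ((c - δ) * (c + δ)) := by
    nlinarith [mul_nonneg (sq_nonneg δ) (by linarith : 0 ≤ 2 * c - 1)]
  have := Real.log_le_log (by positivity) key
  rw [Real.log_mul (by positivity) (by positivity), Real.log_mul h₁.ne' h₃.ne',
    Real.log_mul h₆.ne' h₆.ne', Real.log_mul (by positivity) (by positivity),
    Real.log_mul h₅.ne' h₅.ne', Real.log_mul h₂.ne' h₄.ne'] at this
  linarith

lemma monotoneOn_binEntropy_sub_midpoint {δ : ℝ} (hδ : 0 ≤ δ) :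
    MonotoneOn (fun c => Real.binEntropy c
        - (Real.binEntropy (c - δ) + Real.binEntropy (c + δ)) / 2)
      (Set.Icc (1 / 2) (1 - δ)) := by
  refine monotoneOn_of_hasDerivWithinAt_nonneg (convex_Icc _ _)
    (f' := fun c => (Real.log (1 - c) - Real.log c)
      - ((Real.log (1 - (c - δ)) - Real.log (c - δ))
        + (Real.log (1 - (c + δ)) - Real.log (c + δ))) / 2) (by fun_prop) ?_ ?_
  · intro c hc
    rw [interior_Icc] at hc
    obtain ⟨hc₁, hc₂⟩ := hc
    have center := Real.hasDerivAt_binEntropy (p := c) (by linarith) (by linarith)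
    have left := (Real.hasDerivAt_binEntropy (p := c - δ) (by linarith)
      (by linarith)).comp_sub_const c δ
    have right := (Real.hasDerivAt_binEntropy (p := c + δ) (by linarith)
      (by linarith)).comp_add_const c δ
    exact (center.sub ((left.add right).div_const 2)).hasDerivWithinAt
  · intro c hc
    rw [interior_Icc] at hc
    exact sub_nonneg.2 (binEntropy_slope_midpoint_concave hδ hc.1.le (by linarith [hc.2]))

lemma binEntropy_sub_midpoint_one_sub (c δ : ℝ) :
    Real.binEntropy (1 - c)
        - (Real.binEntropy ((1 - c) - δ) + Real.binEntropy ((1 - c) + δ)) / 2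
      = Real.binEntropy c - (Real.binEntropy (c - δ) + Real.binEntropy (c + δ)) / 2 := by
  rw [show (1 - c) - δ = 1 - (c + δ) by ring, show (1 - c) + δ = 1 - (c - δ) by ring]
  simp only [Real.binEntropy_one_sub]
  ring


/-- The two-forward-pass mutual information
`J(c₀) = H(c₀) - (H(c₀ - δ) + H(c₀ + δ)) / 2` (with `H` the binary entropy and
`0 < δ ≤ 1/2`) attains its minimum over `[δ, 1-δ]` at `c₀ = 1/2`, is monotone
nondecreasing on `[1/2, 1-δ]`, satisfies the symmetry `J(1-c₀) = J(c₀)`, and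
is monotone nonincreasing on `[δ, 1/2]`. -/
theorem twoPass_mutualInformation_min_at_half
    (δ : ℝ) (hδ : 0 < δ) (hδ' : δ ≤ 1 / 2) :
    (∀ c₀ ∈ Set.Icc δ (1 - δ),
        (Real.binEntropy (1 / 2)
            - (Real.binEntropy (1 / 2 - δ) + Real.binEntropy (1 / 2 + δ)) / 2)
          ≤ Real.binEntropy c₀
            - (Real.binEntropy (c₀ - δ) + Real.binEntropy (c₀ + δ)) / 2) ∧
      MonotoneOn (fun c₀ =>
          Real.binEntropy c₀
            - (Real.binEntropy (c₀ - δ) + Real.binEntropy (c₀ + δ)) / 2)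
        (Set.Icc (1 / 2) (1 - δ)) ∧
      (∀ c₀ ∈ Set.Icc δ (1 - δ),
          Real.binEntropy (1 - c₀)
              - (Real.binEntropy ((1 - c₀) - δ) + Real.binEntropy ((1 - c₀) + δ)) / 2
            = Real.binEntropy c₀
              - (Real.binEntropy (c₀ - δ) + Real.binEntropy (c₀ + δ)) / 2) ∧
      AntitoneOn (fun c₀ =>
          Real.binEntropy c₀
            - (Real.binEntropy (c₀ - δ) + Real.binEntropy (c₀ + δ)) / 2)
        (Set.Icc δ (1 / 2)) := by
  have mono := monotoneOn_binEntropy_sub_midpoint hδ.le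
  have anti : AntitoneOn (fun c => Real.binEntropy c
      - (Real.binEntropy (c - δ) + Real.binEntropy (c + δ)) / 2) (Set.Icc δ (1 / 2)) := by
    intro a ha b hb hab
    have h := mono (a := 1 - b) (b := 1 - a) ⟨by linarith [hb.2], by linarith [hb.1]⟩
      ⟨by linarith [ha.2], by linarith [ha.1]⟩ (by linarith)
    simpa only [binEntropy_sub_midpoint_one_sub] using h
  refine ⟨fun c hc => ?_, mono, fun c _ => binEntropy_sub_midpoint_one_sub c δ, anti⟩
  rcases le_total (1 / 2) c with h | h
  · exact mono ⟨le_rfl, by linarith⟩ ⟨h, hc.2⟩ h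
  · exact anti ⟨hc.1, h⟩ ⟨hδ', le_rfl⟩ h
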